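/- arXiv:1912.12471 — 8 statements merged into one kernel-verified Lean document; each statement's English description precedes it below -/
import Mathlib

section
/- Assume the Continuum Hypothesis. Let G be a commutative group whose cardinality equals the cardinality of the continuum. Then there exists a countable family (G_i)_{i<ω} of subgroups of G such that for every nonzero, σ-finite, diffused measure μ on G, at least one of the subgroups G_i is nonmeasurable with respect to μ (i.e., G_i does not belong to the domain σ-algebra of μ). -/
open MeasureTheory Cardinal

/-- A set of elements of an abelian group is independent if the cyclic subgroups they generate
form a direct sum. -/
def CyclicIndependent {G : Type*} [AddCommGroup G] (s : Set G) : Prop :=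
  ∀ f ∈ Finsupp.supported ℤ ℤ s, Finsupp.linearCombination ℤ (id : G → G) f = 0 →
    ∀ x, f x • x = 0

theorem exists_maximal_cyclicIndependent (G : Type*) [AddCommGroup G] :
    ∃ s : Set G, Maximal CyclicIndependent s := by
  refine zorn_subset {s : Set G | CyclicIndependent s} fun c hc hchain ↦ ?_
  rcases c.eq_empty_or_nonempty with rfl | hne
  · refine ⟨∅, fun f hf _ x ↦ ?_, by simp⟩
    have : f = 0 := by simpa [Finsupp.mem_supported] using hf
    simp [this]
  · refine ⟨⋃₀ c, fun f hf h0 ↦ ?_, fun s hs ↦ Set.subset_sUnion_of_mem hs⟩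
    rw [Finsupp.mem_supported] at hf
    obtain ⟨t, htc, ht⟩ := hchain.directedOn.exists_mem_subset_of_finite_of_subset_sUnion hne
      f.support.finite_toSet hf
    exact hc htc f ((Finsupp.mem_supported _ _).2 ht) h0

/-- A maximal independent set generates an essential subgroup. -/
theorem exists_zsmul_eq_linearCombination {G : Type*} [AddCommGroup G] {s : Set G}
    (hs : Maximal CyclicIndependent s) {y : G} (hy : y ≠ 0) :
    ∃ k : ℤ, ∃ f ∈ Finsupp.supported ℤ ℤ s, k • y ≠ 0 ∧
      Finsupp.linearCombination ℤ (id : G → G) f = k • y := by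
  classical
  by_cases hys : y ∈ s
  · exact ⟨1, Finsupp.single y 1, Finsupp.single_mem_supported ℤ 1 hys, by simpa, by simp⟩
  have hn : ¬ CyclicIndependent (insert y s) := fun h ↦
    hys (hs.le_of_ge h (Set.subset_insert y s) (Set.mem_insert y s))
  unfold CyclicIndependent at hn
  push Not at hn
  obtain ⟨f, hf, h0, x, hx⟩ := hn
  have hsum : Finsupp.linearCombination ℤ (id : G → G) (f.erase y) + f y • y = 0 := by
    rw [← h0]
    conv_rhs => rw [← Finsupp.erase_add_single y f]
    simp
  have hers : f.erase y ∈ Finsupp.supported ℤ ℤ s := by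
    rw [Finsupp.mem_supported] at hf ⊢
    intro z hz
    simp only [Finsupp.support_erase, Finset.coe_erase, Set.mem_sdiff,
      Set.mem_singleton_iff] at hz
    exact (hf hz.1).resolve_left hz.2
  refine ⟨-f y, f.erase y, hers, fun hk ↦ hx ?_, ?_⟩
  · have hk' : f y • y = 0 := by simpa using hk
    rw [hk', add_zero] at hsum
    rcases eq_or_ne x y with rfl | hxy
    · exact hk'
    · simpa [Finsupp.erase_ne hxy] using hs.prop _ hers hsum x
  · rw [neg_smul]
    exact eq_neg_of_add_eq_zero_left hsum

/-- The quotient `ℚ / nℤ`, a countable divisible group containing a cyclic group of order `n`. -/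
abbrev RatModNat (n : ℕ) : Type := ℚ ⧸ AddSubgroup.zmultiples (n : ℚ)

noncomputable instance (n : ℕ) : DivisibleBy (RatModNat n) ℤ :=
  QuotientAddGroup.mk_surjective.divisibleBy (QuotientAddGroup.mk' (AddSubgroup.zmultiples (n : ℚ)))
    fun a k ↦ map_zsmul (QuotientAddGroup.mk' (AddSubgroup.zmultiples (n : ℚ))) k a

instance (n : ℕ) : Countable (RatModNat n) :=
  QuotientAddGroup.mk_surjective.countable

theorem zsmul_ratModNat_one_eq_zero (n : ℕ) (k : ℤ) :
    k • ((1 : ℚ) : RatModNat n) = 0 ↔ (n : ℤ) ∣ k := by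
  rw [← QuotientAddGroup.mk_zsmul, QuotientAddGroup.eq_zero_iff, AddSubgroup.mem_zmultiples_iff]
  constructor
  · rintro ⟨j, hj⟩
    refine ⟨j, ?_⟩
    have : (j : ℚ) * n = k := by simpa using hj
    rw [mul_comm]
    exact_mod_cast this.symm
  · rintro ⟨j, rfl⟩
    exact ⟨j, by simp [mul_comm]⟩

theorem baer_dfinsupp {ι : Type*} (D : ι → Type*) [∀ i, AddCommGroup (D i)]
    [∀ i, DivisibleBy (D i) ℤ] : Module.Baer ℤ (Π₀ i, D i) := by
  classical
  have hsurj : ∀ {n : ℤ}, n ≠ 0 → Function.Surjective fun x : Π₀ i, D i ↦ n • x := by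
    intro n hn x
    refine ⟨x.mapRange (fun i a ↦ if a = 0 then 0 else DivisibleBy.div a n) (by simp), ?_⟩
    ext i
    by_cases h : x i = 0
    · simp [h]
    · simp [h, DivisibleBy.div_cancel _ hn]
  let : DivisibleBy (Π₀ i, D i) ℤ := divisibleByOfSMulRightSurj _ _ hsurj
  exact Module.Baer.of_divisible _

/-- Every abelian group embeds into a direct sum, indexed by its elements, of countable groups. -/
theorem exists_injective_dfinsupp (G : Type*) [AddCommGroup G] :
    ∃ φ : G →+ Π₀ x : G, RatModNat (addOrderOf x), Function.Injective φ := by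
  classical
  obtain ⟨s, hs⟩ := exists_maximal_cyclicIndependent G
  let D : G → Type := fun x ↦ RatModNat (addOrderOf x)
  let Φ : (G →₀ ℤ) →ₗ[ℤ] Π₀ x, D x :=
    (Finsupp.liftAddHom fun x ↦ (DFinsupp.singleAddHom D x).comp
      (zmultiplesHom (D x) ((1 : ℚ) : RatModNat (addOrderOf x)))).toIntLinearMap
  have hΦ (f : G →₀ ℤ) (x : G) : Φ f x = f x • ((1 : ℚ) : RatModNat (addOrderOf x)) := by
    induction f using Finsupp.induction_linear with
    | zero => simp
    | add f g hf hg => rw [map_add, DFinsupp.add_apply, hf, hg, Finsupp.add_apply, add_smul]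
    | single y n =>
      rcases eq_or_ne y x with rfl | hyx
      · simp [Φ, D]
      · simp [Φ, D, hyx, DFinsupp.single_eq_of_ne hyx.symm]
  have hΦ0 (f : G →₀ ℤ) : Φ f = 0 ↔ ∀ x, f x • x = 0 := by
    simp only [DFinsupp.ext_iff, hΦ, DFinsupp.zero_apply]
    exact forall_congr' fun x ↦ (zsmul_ratModNat_one_eq_zero _ _).trans
      addOrderOf_dvd_iff_zsmul_eq_zero
  let Ψ := (Finsupp.linearCombination ℤ (id : G → G)).domRestrict (Finsupp.supported ℤ ℤ s)
  let Φs := Φ.domRestrict (Finsupp.supported ℤ ℤ s)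
  have hker : LinearMap.ker Ψ ≤ LinearMap.ker Φs := fun f hf ↦
    (hΦ0 f).2 (hs.prop f f.2 hf)
  have hinj : Function.Injective ((LinearMap.ker Ψ).liftQ Ψ le_rfl) :=
    LinearMap.ker_eq_bot.1 (Submodule.ker_liftQ_eq_bot _ _ _ le_rfl)
  obtain ⟨φ, hφ⟩ := (baer_dfinsupp D).extension_property _ hinj
    ((LinearMap.ker Ψ).liftQ Φs hker)
  refine ⟨φ.toAddMonoidHom, (injective_iff_map_eq_zero _).2 fun y hy ↦ ?_⟩
  by_contra hy0
  obtain ⟨k, f, hf, hk, hfk⟩ := exists_zsmul_eq_linearCombination hs hy0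
  have h1 : φ (Finsupp.linearCombination ℤ (id : G → G) f) = Φ f :=
    LinearMap.congr_fun hφ (Submodule.Quotient.mk ⟨f, hf⟩)
  have h2 : Φ f = 0 := by
    rw [← h1, hfk, map_zsmul, show φ y = 0 from hy, smul_zero]
  rw [hΦ0] at h2
  apply hk
  rw [← hfk, Finsupp.linearCombination_apply]
  exact Finset.sum_eq_zero fun x _ ↦ h2 x

/-- Under CH there is a family of `ℵ₁` sequences only countably many of which are dominated by any
given sequence. -/
theorem exists_countable_setOf_le (hCH : Cardinal.continuum.{0} = Cardinal.aleph 1) :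
    ∃ h : (ℕ → ℕ) → ℕ → ℕ, ∀ g : ℕ → ℕ, {x | h x ≤ g}.Countable := by
  obtain ⟨r, _, hr⟩ := Cardinal.exists_ord_eq (ℕ → ℕ)
  have hcard : #(ℕ → ℕ) = Cardinal.aleph 1 := by simpa using hCH
  have hinit (x : ℕ → ℕ) : {y | r y x}.Countable := by
    have := Cardinal.card_typein_lt x hr
    rw [hcard, ← Cardinal.succ_aleph0, Order.lt_succ_iff] at this
    exact Cardinal.le_aleph0_iff_set_countable.1 this
  have hescape (x : ℕ → ℕ) : ∃ f : ℕ → ℕ, ∀ y, r y x ∨ y = x → ¬ f ≤ y := by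
    obtain ⟨e, he⟩ := ((hinit x).union (Set.countable_singleton x)).exists_eq_range
      ⟨x, Or.inr rfl⟩
    refine ⟨fun n ↦ e n n + 1, fun y hy hle ↦ ?_⟩
    obtain ⟨n, rfl⟩ : y ∈ Set.range e := he ▸ hy
    exact (hle n).not_gt (Nat.lt_succ_self _)
  choose h hh using hescape
  refine ⟨h, fun g ↦ (hinit g).mono fun x hx ↦ ?_⟩
  rcases trichotomous_of r x g with hxg | rfl | hgx
  · exact hxg
  · exact absurd hx (hh x x (Or.inr rfl))
  · exact absurd hx (hh x g (Or.inl hgx))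

/-- A Banach–Kuratowski matrix of sets carries no nonzero finite diffused measure. -/
theorem measure_univ_eq_zero_of_countable_iInter {X : Type*} [MeasurableSpace X] (μ : Measure X)
    [IsFiniteMeasure μ] [NullSingletonClass μ] (A : ℕ → ℕ → Set X)
    (hmeas : ∀ n k, MeasurableSet (A n k)) (hmono : ∀ n, Monotone (A n))
    (hunion : ∀ n, ⋃ k, A n k = Set.univ) (hcount : ∀ g : ℕ → ℕ, (⋂ n, A n (g n)).Countable) :
    μ Set.univ = 0 := by
  by_contra hpos
  obtain ⟨ε, hε, hsum⟩ := ENNReal.exists_pos_sum_of_countable' hpos ℕ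
  have hsmall (n : ℕ) : ∃ k, μ (A n k)ᶜ < ε n := by
    have hlim := tendsto_measure_iInter_atTop (μ := μ) (s := fun k ↦ (A n k)ᶜ)
      (fun k ↦ (hmeas n k).compl.nullMeasurableSet)
      (fun i j hij ↦ Set.compl_subset_compl.2 (hmono n hij)) ⟨0, measure_ne_top _ _⟩
    rw [← Set.compl_iUnion, hunion, Set.compl_univ, measure_empty] at hlim
    exact (hlim.eventually_lt_const (hε n)).exists
  choose g hg using hsmall
  refine lt_irrefl (μ Set.univ) ?_
  calc μ Set.univ = μ ((⋂ n, A n (g n)) ∪ ⋃ n, (A n (g n))ᶜ) := by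
        rw [← Set.compl_iInter, Set.union_compl_self]
    _ ≤ μ (⋂ n, A n (g n)) + ∑' n, μ (A n (g n))ᶜ :=
        (measure_union_le _ _).trans (by gcongr; exact measure_iUnion_le _)
    _ ≤ ∑' n, ε n := by
        rw [(hcount g).measure_zero, zero_add]
        exact ENNReal.tsum_le_tsum fun n ↦ (hg n).le
    _ < μ Set.univ := hsum

theorem countable_setOf_dfinsupp_support {ι : Type*} (D : ι → Type*) [∀ i, Zero (D i)]
    [∀ i, Countable (D i)] {s : Set ι} (hs : s.Countable) :
    {x : Π₀ i, D i | ∀ i, x i ≠ 0 → i ∈ s}.Countable := by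
  classical
  have := hs.to_subtype
  refine Set.MapsTo.countable_of_injOn (f := DFinsupp.subtypeDomain (· ∈ s))
    (Set.mapsTo_univ _ _) (fun x hx y hy hxy ↦ ?_) (Set.to_countable _)
  ext i
  by_cases hi : i ∈ s
  · exact DFunLike.congr_fun hxy ⟨i, hi⟩
  · rw [not_not.1 fun h ↦ hi (hx i h), not_not.1 fun h ↦ hi (hy i h)]

/-- The subgroup of elements whose image in a direct sum is supported in `s`. -/
def supportedSubgroup {G ι : Type*} [AddCommGroup G] {D : ι → Type*} [∀ i, AddCommGroup (D i)]
    (φ : G →+ Π₀ i, D i) (s : Set ι) : AddSubgroup G where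
  carrier := {x | ∀ i ∉ s, φ x i = 0}
  zero_mem' := by simp
  add_mem' hx hy i hi := by simp [hx i hi, hy i hi]
  neg_mem' hx i hi := by simp [hx i hi]

theorem mem_supportedSubgroup {G ι : Type*} [AddCommGroup G] {D : ι → Type*}
    [∀ i, AddCommGroup (D i)] {φ : G →+ Π₀ i, D i} {s : Set ι} {x : G} :
    x ∈ supportedSubgroup φ s ↔ ∀ i ∉ s, φ x i = 0 := Iff.rfl

/-- Under CH, every group of cardinality continuum has a Banach–Kuratowski matrix of subgroups. -/
theorem exists_subgroup_matrix (hCH : Cardinal.continuum.{0} = Cardinal.aleph 1)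
    (G : Type) [AddCommGroup G] (hG : Cardinal.mk G = Cardinal.continuum) :
    ∃ A : ℕ → ℕ → AddSubgroup G, (∀ n, Monotone (A n)) ∧
      (∀ n, ⋃ k, (A n k : Set G) = Set.univ) ∧
      ∀ g : ℕ → ℕ, (⋂ n, (A n (g n) : Set G)).Countable := by
  classical
  obtain ⟨h, hh⟩ := exists_countable_setOf_le hCH
  obtain ⟨e⟩ : Nonempty (G ≃ (ℕ → ℕ)) := Cardinal.eq.1 (by simp [hG])
  obtain ⟨φ, hφ⟩ := exists_injective_dfinsupp G
  refine ⟨fun n k ↦ supportedSubgroup φ {i | h (e i) n ≤ k}, fun n k l hkl x hx i hi ↦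
    hx i fun hik ↦ hi (le_trans hik hkl), fun n ↦ Set.eq_univ_of_forall fun x ↦ ?_, fun g ↦ ?_⟩
  · refine Set.mem_iUnion.2 ⟨(φ x).support.sup fun i ↦ h (e i) n, fun i hi ↦ ?_⟩
    by_contra hne
    exact hi (Finset.le_sup (f := fun i ↦ h (e i) n) (DFinsupp.mem_support_iff.2 hne))
  · have hs : {i | h (e i) ≤ g}.Countable := (hh g).preimage e.injective
    refine ((countable_setOf_dfinsupp_support
      (fun x : G ↦ RatModNat (addOrderOf x)) hs).preimage hφ).mono fun x hx ↦ ?_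
    rw [Set.mem_preimage, Set.mem_ofPred_eq]
    intro i hne n
    by_contra hin
    exact hne (mem_supportedSubgroup.1 (Set.mem_iInter.1 hx n) i hin)

theorem continuum_eq_aleph_one_of_univ.{u} (hCH : Cardinal.continuum.{u} = Cardinal.aleph 1) :
    Cardinal.continuum.{0} = Cardinal.aleph 1 :=
  Cardinal.lift_injective.{u, 0} (by simpa using hCH)

/-- Assume CH. If `G` is a commutative group of cardinality continuum,
then there is a countable family of subgroups of `G` such that every nonzero, σ-finite,
diffused measure on `G` (defined on a σ-algebra containing all singletons) fails to
measure at least one of them. -/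
theorem nonmeasurable_subgroups_of_card_continuum
    (hCH : Cardinal.continuum = Cardinal.aleph 1)
    (G : Type) [AddCommGroup G] (hG : Cardinal.mk G = Cardinal.continuum) :
    ∃ Gs : ℕ → AddSubgroup G,
      ∀ (m : MeasurableSpace G) (μ : @Measure G m),
        (∀ x : G, MeasurableSet[m] {x}) →
        (∀ x : G, μ {x} = 0) →
        @SigmaFinite G m μ →
        0 < μ Set.univ →
        ∃ i : ℕ, ¬ MeasurableSet[m] (Gs i : Set G) := by
  obtain ⟨A, hmono, hunion, hcount⟩ := exists_subgroup_matrix (continuum_eq_aleph_one_of_univ hCH) G hG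
  refine ⟨fun i ↦ A i.unpair.1 i.unpair.2, fun m μ _ hdiff _ hpos ↦ ?_⟩
  by_contra! hmeas
  obtain ⟨ν, _, hμν, hνμ⟩ := exists_isFiniteMeasure_absolutelyContinuous μ
  have : NullSingletonClass ν := ⟨fun x ↦ hνμ (hdiff x)⟩
  refine hpos.ne' (hμν (measure_univ_eq_zero_of_countable_iInter ν
    (fun n k ↦ (A n k : Set G)) (fun n k ↦ ?_) hmono hunion hcount))
  simpa using hmeas (Nat.pair n k)
end

section
/- Let G be a commutative group of cardinality ω₁ (the first uncountable cardinal). Then there exists a countable family (G_i)_{i<ω} of subgroups of G such that for every nonzero, σ-finite, diffused measure μ on G, at least one of the subgroups G_i is nonmeasurable with respect to μ (i.e., G_i does not belong to the domain σ-algebra of μ). (No form of the Continuum Hypothesis is assumed.) -/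
open MeasureTheory Cardinal

/-- Every cyclic subgroup embeds into the countable divisible group `ℚ × ℚ/ℤ`. -/
theorem exists_injective_zmultiples_rat_prod_addCircle {G : Type*} [AddCommGroup G] (x : G) :
    ∃ f : AddSubgroup.zmultiples x →+ ℚ × AddCircle (1 : ℚ), Function.Injective f := by
  obtain ⟨c, hc⟩ : ∃ c : ℚ × AddCircle (1 : ℚ), addOrderOf c = addOrderOf x := by
    rcases Nat.eq_zero_or_pos (addOrderOf x) with h | h
    · refine ⟨(1, 0), ?_⟩
      rw [h, addOrderOf_eq_zero_iff]
      exact fun hfin => not_isOfFinAddOrder_of_isAddTorsionFree (one_ne_zero (α := ℚ))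
        ((AddMonoidHom.fst ℚ (AddCircle (1 : ℚ))).isOfFinAddOrder hfin)
    · refine ⟨(0, ((1 / (addOrderOf x : ℚ) : ℚ) : AddCircle (1 : ℚ))), ?_⟩
      rw [Prod.addOrderOf, AddCircle.addOrderOf_period_div h]
      simp
  let e : AddSubgroup.zmultiples x ≃+ AddSubgroup.zmultiples c :=
    addEquivOfAddCyclicCardEq (by rw [Nat.card_zmultiples, Nat.card_zmultiples, hc])
  exact ⟨(AddSubgroup.zmultiples c).subtype.comp e.toAddMonoidHom,
    Subtype.val_injective.comp e.injective⟩

/-- There is a maximal independent family of cyclic submodules: every nonzero cyclic submodule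
meets its span. -/
theorem exists_sSupIndep_span_singleton_essential (R M : Type*) [Ring R] [AddCommGroup M]
    [Module R M] :
    ∃ s : Set (Submodule R M), sSupIndep s ∧ (∀ a ∈ s, ∃ x, a = Submodule.span R {x}) ∧
      ∀ x, Disjoint (Submodule.span R {x}) (sSup s) → x = 0 := by
  obtain ⟨s, hs⟩ := zorn_subset
    {s : Set (Submodule R M) | sSupIndep s ∧ ∀ a ∈ s, ∃ x, a = Submodule.span R {x}}
    fun c hc hchain => ⟨⋃₀ c, ⟨iSupIndep_sUnion_of_directed hchain.directedOn
      fun t ht => (hc ht).1, fun a ⟨t, ht, hat⟩ => (hc ht).2 a hat⟩,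
      fun _ => Set.subset_sUnion_of_mem⟩
  refine ⟨s, hs.prop.1, hs.prop.2, fun x hx => ?_⟩
  have hmem : Submodule.span R {x} ∈ s := by
    refine hs.le_of_ge (y := insert (Submodule.span R {x}) s) ⟨?_, ?_⟩
      (Set.subset_insert _ _) (Set.mem_insert _ _)
    · intro a ha
      by_cases hax : a = Submodule.span R {x}
      · subst hax
        exact hx.mono_right (sSup_le_sSup (by simp))
      · have has : a ∈ s := ha.resolve_left hax
        rw [Set.insert_sdiff_of_notMem _ (by simpa using Ne.symm hax), sSup_insert, sup_comm]
        refine (hs.prop.1 has).disjoint_sup_right_of_disjoint_sup_left (hx.symm.mono_left ?_)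
        exact sup_le (le_sSup has) (sSup_le_sSup Set.sdiff_subset)
    · rintro a (rfl | ha)
      exacts [⟨x, rfl⟩, hs.prop.2 a ha]
  have := hx.mono_right (le_sSup hmem)
  rwa [disjoint_self, Submodule.span_singleton_eq_bot] at this

/-- Every commutative group embeds into a direct sum of copies of `ℚ × ℚ/ℤ`. -/
theorem exists_injective_finsupp_rat_prod_addCircle (G : Type*) [AddCommGroup G] :
    ∃ (s : Set (Submodule ℤ G)) (F : G →+ (s →₀ ℚ × AddCircle (1 : ℚ))),
      (∀ a ∈ s, ∃ x, a = Submodule.span ℤ {x}) ∧ Function.Injective F := by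
  classical
  obtain ⟨s, hs, hcyc, hess⟩ := exists_sSupIndep_span_singleton_essential ℤ G
  have hemb (a : s) : ∃ f : a.1.toAddSubgroup →+ ℚ × AddCircle (1 : ℚ),
      Function.Injective f := by
    obtain ⟨x, hx⟩ := hcyc a a.2
    rw [hx, Submodule.span_singleton_toAddSubgroup_eq_zmultiples]
    exact exists_injective_zmultiples_rat_prod_addCircle x
  choose f hf using hemb
  let i : (Π₀ a : s, a.1.toAddSubgroup) →+ G :=
    DFinsupp.sumAddHom fun a : s => a.1.toAddSubgroup.subtype
  have hi : Function.Injective i :=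
    iSupIndep.dfinsuppSumAddHom_injective <|
      (iSupIndep_map_orderIso_iff AddSubgroup.toIntSubmodule.symm).2 ((sSupIndep_iff s).1 hs)
  let j : (Π₀ a : s, a.1.toAddSubgroup) →+ (s →₀ ℚ × AddCircle (1 : ℚ)) :=
    (finsuppAddEquivDFinsupp (ι := s) (M := ℚ × AddCircle (1 : ℚ))).symm.toAddMonoidHom.comp
      (DFinsupp.mapRange.addMonoidHom f)
  have hj : Function.Injective j := finsuppAddEquivDFinsupp.symm.injective.comp
    ((DFinsupp.mapRange_injective (fun a => f a) fun a => map_zero _).2 hf)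
  let _ : DivisibleBy (s →₀ ℚ × AddCircle (1 : ℚ)) ℤ := divisibleByOfSMulRightSurj _ _
    fun {n} hn => Finsupp.mapRange_surjective (n • ·) (smul_zero n) <|
      DivisibleBy.surjective_smul (ℚ × AddCircle (1 : ℚ)) ℤ hn
  obtain ⟨F, hF⟩ := (Module.Baer.of_divisible
    (s →₀ ℚ × AddCircle (1 : ℚ))).extension_property_addMonoidHom i hi j
  refine ⟨s, F, hcyc, (injective_iff_map_eq_zero F).2 fun x hx => hess x ?_⟩
  rw [Submodule.disjoint_def]
  intro y hy hys
  have hle : sSup s ≤ AddSubgroup.toIntSubmodule i.range := sSup_le fun a ha z hz =>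
    ⟨DFinsupp.single ⟨a, ha⟩ ⟨z, hz⟩, DFinsupp.sumAddHom_single _ _ _⟩
  obtain ⟨w, rfl⟩ := hle hys
  have hFw : F (i w) = 0 := by
    obtain ⟨n, hn⟩ := Submodule.mem_span_singleton.1 hy
    rw [← hn, map_zsmul, hx, smul_zero]
  have hjw : j w = 0 := by rw [← hF, AddMonoidHom.comp_apply, hFw]
  rw [(injective_iff_map_eq_zero j).1 hj w hjw, map_zero]

/-- A type of cardinality at most `ℵ₁` has a linear order whose initial segments are simultaneously
enumerated by countably many functions. -/
theorem exists_linearOrder_range_eq_Iic {I : Type*} (hI : #I ≤ ℵ₁) :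
    ∃ (_ : LinearOrder I) (g : ℕ → I → I), ∀ b, Set.range (fun n => g n b) = Set.Iic b := by
  obtain ⟨e⟩ : Nonempty (I ≃ (#I).ord.ToType) := Cardinal.eq.1 (by simp)
  let _ : LinearOrder I := LinearOrder.lift' e e.injective
  have hcount (b : I) : (Set.Iic b).Countable := by
    have h : (Set.Iio (e b)).Countable := by
      rw [← le_aleph0_iff_set_countable, ← Order.lt_succ_iff, succ_aleph0]
      exact (mk_Iio_lt (e b) (by simp)).trans_le (by simpa using hI)
    have hIic : (Set.Iic (e b)).Countable := by
      rw [← Set.Iio_insert]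
      exact h.insert _
    exact hIic.preimage e.injective
  choose g hg using fun b : I => (hcount b).exists_eq_range ⟨b, Set.self_mem_Iic⟩
  exact ⟨inferInstance, fun n b => g b n, fun b => (hg b).symm⟩

/-- On a set of cardinality at most the continuum, a countable family of sets separates finite sets
from points outside them. -/
theorem exists_countable_separating_finset {I : Type*} (r : I → ℝ) (hr : Function.Injective r) :
    ∃ A : ℚ × ℚ → Set I, ∀ (H : Finset I) (a : I), a ∉ H → ∃ t, (H : Set I) ⊆ A t ∧ a ∉ A t := by
  refine ⟨fun t => {i | r i ∉ Set.Ioo (t.1 : ℝ) t.2}, fun H a ha => ?_⟩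
  have hopen : IsOpen (r '' (H : Set I))ᶜ := (H.finite_toSet.image r).isClosed.isOpen_compl
  have hmem : r a ∈ (r '' (H : Set I))ᶜ := by
    rintro ⟨b, hb, hab⟩
    exact ha (hr hab ▸ hb)
  obtain ⟨V, hV, haV, hsub⟩ := Real.isTopologicalBasis_Ioo_rat.exists_subset_of_mem_open hmem hopen
  simp only [Set.mem_iUnion, Set.mem_singleton_iff] at hV
  obtain ⟨p, q, -, rfl⟩ := hV
  exact ⟨(p, q), fun b hb hbV => hsub hbV ⟨b, hb, rfl⟩, fun h => h haV⟩

/-- If the finite supports `s x` are countable-to-one and sufficiently many sets defined by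
inclusions of supports are measurable, then a σ-finite diffused measure vanishes, by the Fubini
theorem applied to the relation that `s x` is bounded by `s y`. -/
theorem measure_eq_zero_of_measurableSet_support {G I T : Type*} [LinearOrder I] [Countable T]
    (s : G → Finset I) (hs : ∀ S : Set I, S.Countable → {x | (s x : Set I) ⊆ S}.Countable)
    (g : ℕ → I → I) (hg : ∀ b, Set.range (fun n => g n b) = Set.Iic b)
    (A : T → Set I) (hA : ∀ (H : Finset I) (a : I), a ∉ H → ∃ t, (H : Set I) ⊆ A t ∧ a ∉ A t)
    [MeasurableSpace G] (μ : Measure G) [SigmaFinite μ] [NullSingletonClass μ]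
    (hm : ∀ t, MeasurableSet {x | (s x : Set I) ⊆ A t})
    (hmg : ∀ n t, MeasurableSet {x | (s x : Set I) ⊆ {b | ∀ k ≤ n, g k b ∈ A t}}) :
    μ = 0 := by
  classical
  have hIic (b : I) : (Set.Iic b).Countable := hg b ▸ Set.countable_range _
  let R : Set (G × G) := {p | ∀ a ∈ s p.1, ∃ b ∈ s p.2, a ≤ b}
  have hR : R = ⋃ n, ⋂ t, (Prod.snd ⁻¹' {x | (s x : Set I) ⊆ {b | ∀ k ≤ n, g k b ∈ A t}})ᶜ ∪
      Prod.fst ⁻¹' {x | (s x : Set I) ⊆ A t} := by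
    ext ⟨x, y⟩
    simp only [R, Set.mem_ofPred_eq, Set.mem_iUnion, Set.mem_iInter, Set.mem_union, Set.mem_compl_iff,
      Set.mem_preimage, ← imp_iff_not_or]
    constructor
    · intro h
      have hex (a : s x) : ∃ n, ∃ b ∈ s y, g n b = a := by
        obtain ⟨b, hb, hab⟩ := h a a.2
        obtain ⟨n, hn⟩ : (a : I) ∈ Set.range fun n => g n b := hg b ▸ hab
        exact ⟨n, b, hb, hn⟩
      choose n hn using hex
      refine ⟨Finset.univ.sup n, fun t ht a ha => ?_⟩
      obtain ⟨b, hb, hab⟩ := hn ⟨a, ha⟩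
      have := ht hb (n ⟨a, ha⟩) (Finset.le_sup (Finset.mem_univ _))
      rwa [hab] at this
    · rintro ⟨n, h⟩ a ha
      by_contra! hlt
      obtain ⟨t, ht, hat⟩ := hA ((Finset.range (n + 1) ×ˢ s y).image fun p => g p.1 p.2) a <| by
        simp only [Finset.mem_image, Finset.mem_product, not_exists, not_and]
        rintro ⟨k, b⟩ ⟨-, hb⟩ rfl
        have : g k b ∈ Set.Iic b := hg b ▸ ⟨k, rfl⟩
        exact (hlt b hb).not_ge this
      refine hat (h t (fun b hb k hk => ht ?_) ha)
      rw [Finset.mem_coe, Finset.mem_image]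
      exact ⟨(k, b), by simpa using ⟨by lia, hb⟩, rfl⟩
  have hRm : MeasurableSet R := by
    rw [hR]
    exact .iUnion fun n => .iInter fun t =>
      ((hmg n t).preimage measurable_snd).compl.union ((hm t).preimage measurable_fst)
  have hbelow (y : G) : {x | (x, y) ∈ R}.Countable := by
    refine (hs (⋃ b ∈ s y, Set.Iic b) ((s y).countable_toSet.biUnion fun b _ => hIic b)).mono
      fun x (hx : (x, y) ∈ R) => ?_
    intro a ha
    obtain ⟨b, hb, hab⟩ := hx a ha
    exact Set.mem_biUnion (Finset.mem_coe.2 hb) hab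
  have habove (x : G) : {y | (x, y) ∉ R}.Countable := by
    refine (((s x).countable_toSet).biUnion fun a _ => hs (Set.Iic a) (hIic a)).mono fun y hy => ?_
    simp only [R, Set.mem_ofPred_eq, not_forall] at hy
    obtain ⟨a, ha, hy⟩ := hy
    push Not at hy
    exact Set.mem_biUnion (Finset.mem_coe.2 ha) fun b hb => (hy b hb).le
  have h1 : μ.prod μ R = 0 := by
    rw [Measure.prod_apply_symm hRm]
    simp only [Set.preimage, (hbelow _).measure_zero μ, lintegral_zero]
  have h2 : μ.prod μ Rᶜ = 0 := by
    rw [Measure.prod_apply hRm.compl]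
    simp only [Set.preimage, Set.mem_compl_iff, (habove _).measure_zero μ, lintegral_zero]
  have huniv : μ.prod μ (Set.univ ×ˢ Set.univ) = 0 := by
    rw [Set.univ_prod_univ, ← Set.union_compl_self R]
    exact measure_union_null h1 h2
  rw [Measure.prod_prod, mul_self_eq_zero] at huniv
  exact Measure.measure_univ_eq_zero.1 huniv

/-- (No CH assumed.) If `G` is a commutative group of cardinality `ω₁`,
then there is a countable family of subgroups of `G` such that every nonzero, σ-finite,
diffused measure on `G` (defined on a σ-algebra containing all singletons) fails to
measure at least one of them. -/
theorem nonmeasurable_subgroups_of_card_aleph_one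
    (G : Type) [AddCommGroup G] (hG : Cardinal.mk G = Cardinal.aleph 1) :
    ∃ Gs : ℕ → AddSubgroup G,
      ∀ (m : MeasurableSpace G) (μ : @Measure G m),
        (∀ x : G, MeasurableSet[m] {x}) →
        (∀ x : G, μ {x} = 0) →
        @SigmaFinite G m μ →
        0 < μ Set.univ →
        ∃ i : ℕ, ¬ MeasurableSet[m] (Gs i : Set G) := by
  obtain ⟨s, F, hcyc, hF⟩ := exists_injective_finsupp_rat_prod_addCircle G
  have hs : #s ≤ ℵ₁ := by
    choose x hx using hcyc
    rw [← hG]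
    refine mk_le_of_injective (f := fun a : s => x a a.2) fun a b hab => Subtype.ext ?_
    rw [hx a a.2, hx b b.2]
    exact congrArg (fun z => Submodule.span ℤ {z}) hab
  obtain ⟨_, g, hg⟩ := exists_linearOrder_range_eq_Iic hs
  obtain ⟨r⟩ : Nonempty (s ↪ ℝ) := by
    rw [← Cardinal.le_def, mk_real]
    exact hs.trans aleph_one_le_continuum
  obtain ⟨A, hA⟩ := exists_countable_separating_finset r r.injective
  let K (S : Set s) : AddSubgroup G :=
    (Finsupp.supported (ℚ × AddCircle (1 : ℚ)) ℤ S).toAddSubgroup.comap F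
  have hK (S : Set s) : (K S : Set G) = {x | ((F x).support : Set s) ⊆ S} := rfl
  have hcount (S : Set s) (hS : S.Countable) : {x | ((F x).support : Set s) ⊆ S}.Countable := by
    have := hS.to_subtype
    have : Countable (AddCircle (1 : ℚ)) := Quotient.countable
    have : (Finsupp.supported (ℚ × AddCircle (1 : ℚ)) ℤ S :
        Set (s →₀ ℚ × AddCircle (1 : ℚ))).Countable :=
      Set.countable_coe_iff.1 (Finsupp.supportedEquivFinsupp S).toEquiv.injective.countable
    exact this.preimage hF
  obtain ⟨e, he⟩ := exists_surjective_nat ((ℚ × ℚ) ⊕ (ℕ × (ℚ × ℚ)))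
  refine ⟨fun i => Sum.elim (fun t => K (A t))
    (fun p => K {b | ∀ k ≤ p.1, g k b ∈ A p.2}) (e i), ?_⟩
  intro m μ _ hdiff hσ hpos
  by_contra! hmeas
  have : NullSingletonClass μ := ⟨hdiff⟩
  refine hpos.ne' (Measure.measure_univ_eq_zero.2 ?_)
  refine measure_eq_zero_of_measurableSet_support (fun x => (F x).support) hcount g hg A hA μ
    (fun t => ?_) fun n t => ?_
  · obtain ⟨i, hi⟩ := he (.inl t)
    simpa only [hi, Sum.elim_inl, hK] using hmeas i
  · obtain ⟨i, hi⟩ := he (.inr (n, t))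
    simpa only [hi, Sum.elim_inr, hK] using hmeas i
end

section
/- Assume the Continuum Hypothesis. Then for every set E with card(E) = ω₁ there exists a Banach–Kuratowski matrix over E, i.e., a double sequence (E_{m,n})_{m<ω, n<ω} of subsets of E such that: (a) E_{m,0} ⊆ E_{m,1} ⊆ … ⊆ E_{m,n} ⊆ … for every m < ω; (b) E = ⋃_{n<ω} E_{m,n} for every m < ω; and (c) for every function f : ω → ω, the intersection ⋂_{m<ω} E_{m,f(m)} is at most countable. -/
open Cardinal

/-- Countably many sequences can be evaded by a single sequence that exceeds each of them
at some index. -/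
theorem Set.Countable.exists_forall_exists_lt {S : Set (ℕ → ℕ)} (hS : S.Countable) :
    ∃ g : ℕ → ℕ, ∀ f ∈ S, ∃ n, f n < g n := by
  rcases S.eq_empty_or_nonempty with rfl | hne
  · exact ⟨0, by simp⟩
  · obtain ⟨c, rfl⟩ := hS.exists_eq_range hne
    refine ⟨fun n => c n n + 1, ?_⟩
    rintro _ ⟨n, rfl⟩
    exact ⟨n, Nat.lt_succ_self _⟩

/-- Assume CH. Every set (type) `E` of cardinality `ω₁` carries a
Banach–Kuratowski matrix: a double sequence `(E m n)` of subsets, increasing in `n` for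
each `m`, covering `E` for each `m`, and such that for every `f : ℕ → ℕ` the intersection
`⋂ m, E m (f m)` is at most countable. -/
theorem exists_banach_kuratowski_matrix
    (hCH : Cardinal.continuum = Cardinal.aleph 1)
    (E : Type) (hE : Cardinal.mk E = Cardinal.aleph 1) :
    ∃ M : ℕ → ℕ → Set E,
      (∀ m : ℕ, Monotone (M m)) ∧
      (∀ m : ℕ, ⋃ n : ℕ, M m n = Set.univ) ∧
      (∀ f : ℕ → ℕ, (⋂ m : ℕ, M m (f m)).Countable) := by
  have continuum_eq : (Cardinal.continuum : Cardinal.{0}) = Cardinal.aleph 1 :=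
    Cardinal.lift_injective (by simpa using hCH)
  obtain ⟨e⟩ : Nonempty (E ≃ (ℕ → ℕ)) := Cardinal.eq.1 (by simpa [hE] using continuum_eq.symm)
  obtain ⟨_, _, hord⟩ := Cardinal.exists_ord_eq_type_lt E
  have countable_Iio (x : E) : (Set.Iio x).Countable := by
    rw [← Cardinal.le_aleph0_iff_set_countable, ← Order.lt_succ_iff, Cardinal.succ_aleph0, ← hE]
    exact Cardinal.mk_Iio_lt x hord
  have countable_Iic (x : E) : (Set.Iic x).Countable := by
    rw [← Set.Iio_insert]
    exact (countable_Iio x).insert x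
  choose g hg using fun x => ((countable_Iic x).image e).exists_forall_exists_lt
  refine ⟨fun m n => {x | g x m ≤ n}, fun m a b hab x hx => le_trans hx hab,
    fun m => Set.eq_univ_of_forall fun x => Set.mem_iUnion.2 ⟨g x m, le_refl (g x m)⟩,
    fun f => (countable_Iio (e.symm f)).mono fun x hx => ?_⟩
  by_contra hlt
  obtain ⟨n, hn⟩ := hg x f ⟨e.symm f, not_lt.1 hlt, e.apply_symm_apply f⟩
  exact hn.not_ge (Set.mem_iInter.1 hx n)
end

section
/- Let E be a set of cardinality ω₁ and let (E_{m,n})_{m<ω,n<ω} be a Banach–Kuratowski matrix over E. Then there does not exist a nonzero, σ-finite, diffused measure on E defined simultaneously for all the sets E_{m,n} (i.e., no such measure has a domain σ-algebra containing every E_{m,n}). -/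
open MeasureTheory Cardinal

/-- For a finite measure, measurable sets increasing to the whole space along each row admit a
selection, one from each row, whose intersection has positive measure. -/
theorem exists_measure_iInter_pos {α : Type*} [MeasurableSpace α] (μ : Measure α)
    [IsFiniteMeasure μ] (hμ : μ ≠ 0) (M : ℕ → ℕ → Set α)
    (hmeas : ∀ m n, MeasurableSet (M m n)) (hmono : ∀ m, Monotone (M m))
    (hunion : ∀ m, ⋃ n, M m n = Set.univ) :
    ∃ f : ℕ → ℕ, 0 < μ (⋂ m, M m (f m)) := by
  obtain ⟨ε, hε, hsum⟩ := ENNReal.exists_pos_sum_of_countable'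
    (Measure.measure_univ_ne_zero.2 hμ) ℕ
  have small : ∀ m, ∃ n, μ (M m n)ᶜ < ε m := by
    intro m
    have h := tendsto_measure_iInter_atTop (μ := μ) (s := fun n ↦ (M m n)ᶜ)
      (fun n ↦ (hmeas m n).compl.nullMeasurableSet)
      (fun a b hab ↦ Set.compl_subset_compl.2 (hmono m hab)) ⟨0, measure_ne_top μ _⟩
    rw [← Set.compl_iUnion, hunion m, Set.compl_univ, measure_empty] at h
    exact (h.eventually_lt_const (hε m)).exists
  choose f hf using small
  refine ⟨f, pos_iff_ne_zero.2 fun h0 ↦ ?_⟩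
  have hlt : μ (⋂ m, M m (f m))ᶜ < μ Set.univ := by
    rw [Set.compl_iInter]
    exact ((measure_iUnion_le _).trans (ENNReal.tsum_le_tsum fun m ↦ (hf m).le)).trans_lt hsum
  exact hlt.ne (measure_congr (Filter.eventuallyEq_univ.2 (compl_mem_ae_iff.2 h0)))

/-- If `E` has cardinality `ω₁` and `(M m n)` is a Banach–Kuratowski
matrix over `E`, then there is no nonzero, σ-finite, diffused measure on `E` whose domain
σ-algebra (containing all singletons) contains every set `M m n`. -/
theorem no_measure_on_banach_kuratowski_matrix
    (E : Type) (hE : Cardinal.mk E = Cardinal.aleph 1)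
    (M : ℕ → ℕ → Set E)
    (hMono : ∀ m : ℕ, Monotone (M m))
    (hUnion : ∀ m : ℕ, ⋃ n : ℕ, M m n = Set.univ)
    (hInter : ∀ f : ℕ → ℕ, (⋂ m : ℕ, M m (f m)).Countable) :
    ¬ ∃ (s : MeasurableSpace E) (μ : @Measure E s),
        (∀ x : E, MeasurableSet[s] {x}) ∧
        (∀ m n : ℕ, MeasurableSet[s] (M m n)) ∧
        (∀ x : E, μ {x} = 0) ∧
        @SigmaFinite E s μ ∧
        0 < μ Set.univ := by
  rintro ⟨s, μ, -, hmeas, hdiff, hσ, hpos⟩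
  have hμ : μ.toFinite ≠ 0 := by
    intro h
    have hac := absolutelyContinuous_toFinite μ
    rw [h] at hac
    exact hpos.ne' (hac (by simp))
  obtain ⟨f, hf⟩ := exists_measure_iInter_pos μ.toFinite hμ M hmeas hMono hUnion
  refine hf.ne' (toFinite_absolutelyContinuous μ ?_)
  rw [← Set.biUnion_of_singleton (⋂ m, M m (f m))]
  exact (measure_biUnion_null_iff (hInter f)).2 fun x _ ↦ hdiff x
end

section
/- Let (N_n)_{n<ω} be a small system on a nonempty set X and let S be a σ-algebra on X that is admissible with respect to (N_n)_{n<ω}. If (N_n)_{n<ω} is upper semicontinuous relative to S, then (N_n)_{n<ω} is also upper semicontinuous relative to S̃, the σ-algebra generated by S together with the σ-ideal N_∞. -/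
open MeasureTheory

/-- A small system on `X`: a sequence of hereditary classes of subsets of `X`
satisfying conditions (i)–(v) of Definition 2.1. -/
def IsSmallSystem {X : Type} (N : ℕ → Set (Set X)) : Prop :=
  (∀ n, (∅ : Set X) ∈ N n) ∧
  (∀ n, ∀ E F : Set X, E ∈ N n → F ⊆ E → F ∈ N n) ∧
  (∀ n, ∀ E F : Set X, E ∈ N n → (∀ k, F ∈ N k) → E ∪ F ∈ N n) ∧
  (∀ m : ℕ, ∃ m' : ℕ, m' > m ∧
    ∀ nk : ℕ → ℕ, Function.Injective nk → (∀ k, nk k > m') →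
      ∀ E : ℕ → Set X, (∀ k, E k ∈ N (nk k)) → (⋃ k, E k) ∈ N m) ∧
  (∀ p q : ℕ, ∃ m : ℕ, m > p ∧ m > q ∧ N m ⊆ N p ∧ N m ⊆ N q)

/-- `N_∞ = ⋂ n, N n`. -/
def NInf {X : Type} (N : ℕ → Set (Set X)) : Set (Set X) := ⋂ n, N n

/-- A σ-algebra `S` on `X` is admissible with respect to a small system `(N n)`
(Definition 2.2): (i) `S \ N n` and `S ∩ N n` are nonempty; (ii) each `N n` has an
`S`-base; (iii) `S \ N n` satisfies the countable chain condition. -/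
def IsAdmissible {X : Type} (S : MeasurableSpace X) (N : ℕ → Set (Set X)) : Prop :=
  (∀ n, (∃ A : Set X, MeasurableSet[S] A ∧ A ∉ N n) ∧
        (∃ A : Set X, MeasurableSet[S] A ∧ A ∈ N n)) ∧
  (∀ n, ∀ E ∈ N n, ∃ F : Set X, MeasurableSet[S] F ∧ F ∈ N n ∧ E ⊆ F) ∧
  (∀ n, ∀ C : Set (Set X),
    (∀ A ∈ C, MeasurableSet[S] A ∧ A ∉ N n) → C.PairwiseDisjoint id → C.Countable)

/-- A small system `(N n)` is upper semicontinuous relative to a σ-algebra `S`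
(Definition 2.3): for every decreasing sequence of `S`-measurable sets all lying
outside some fixed `N m`, the intersection lies outside `N_∞`. -/
def IsUpperSemicontinuous {X : Type} (N : ℕ → Set (Set X)) (S : MeasurableSpace X) : Prop :=
  ∀ E : ℕ → Set X, (∀ k, MeasurableSet[S] (E k)) → Antitone E →
    (∃ m, ∀ k, E k ∉ N m) → (⋂ k, E k) ∉ NInf N

/-- `S̃`: the σ-algebra generated by `S` together with the σ-ideal `N_∞`. -/
def STilde {X : Type} (S : MeasurableSpace X) (N : ℕ → Set (Set X)) : MeasurableSpace X :=
  MeasurableSpace.generateFrom ({A : Set X | MeasurableSet[S] A} ∪ NInf N)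

theorem mem_nInf {X : Type} {N : ℕ → Set (Set X)} {A : Set X} :
    A ∈ NInf N ↔ ∀ n, A ∈ N n := by
  simp [NInf]

namespace IsSmallSystem

variable {X : Type} {N : ℕ → Set (Set X)}

theorem nInf_mono (hN : IsSmallSystem N) {A B : Set X} (hA : A ∈ NInf N) (h : B ⊆ A) :
    B ∈ NInf N :=
  mem_nInf.2 fun n => hN.2.1 n A B (mem_nInf.1 hA n) h

theorem empty_mem_nInf (hN : IsSmallSystem N) : (∅ : Set X) ∈ NInf N :=
  mem_nInf.2 hN.1

theorem union_mem_nInf (hN : IsSmallSystem N) {A B : Set X} (hA : A ∈ NInf N)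
    (hB : B ∈ NInf N) : A ∪ B ∈ NInf N :=
  mem_nInf.2 fun n => hN.2.2.1 n A B (mem_nInf.1 hA n) (mem_nInf.1 hB)

theorem iUnion_mem_nInf (hN : IsSmallSystem N) {A : ℕ → Set X} (hA : ∀ k, A k ∈ NInf N) :
    (⋃ k, A k) ∈ NInf N := by
  refine mem_nInf.2 fun m => ?_
  obtain ⟨m', -, h⟩ := hN.2.2.2.1 m
  exact h (fun k => m' + 1 + k) (fun a b hab => by simpa using hab) (fun k => by lia) A
    fun k => mem_nInf.1 (hA k) _

/-- Every set of `S̃` agrees with a set of `S` up to a set of `N_∞`. -/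
theorem exists_symmDiff_mem_nInf (hN : IsSmallSystem N) {S : MeasurableSpace X} {A : Set X}
    (hA : MeasurableSet[STilde S N] A) :
    ∃ F : Set X, MeasurableSet[S] F ∧ symmDiff A F ∈ NInf N := by
  induction A, hA using MeasurableSpace.generateFrom_induction with
  | hC A hA _ =>
    rcases hA with hA | hA
    · exact ⟨A, hA, by simpa using hN.empty_mem_nInf⟩
    · exact ⟨∅, MeasurableSet.empty, hN.nInf_mono hA (by simp [Set.symmDiff_def])⟩
  | empty => exact ⟨∅, MeasurableSet.empty, by simpa using hN.empty_mem_nInf⟩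
  | compl A _ ih =>
    obtain ⟨F, hF, h⟩ := ih
    exact ⟨Fᶜ, hF.compl, by rwa [compl_symmDiff_compl]⟩
  | iUnion A _ ih =>
    choose F hF h using ih
    refine ⟨⋃ k, F k, MeasurableSet.iUnion hF, hN.nInf_mono (hN.iUnion_mem_nInf h) ?_⟩
    intro x
    simp only [Set.mem_symmDiff, Set.mem_iUnion]
    grind

end IsSmallSystem

/-- **Proposition 2.4.** If `S` is admissible with respect to the small
system `(N n)` and `(N n)` is upper semicontinuous relative to `S`, then `(N n)` is
upper semicontinuous relative to `S̃`. -/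
theorem upperSemicontinuous_sTilde
    (X : Type) [Nonempty X] (N : ℕ → Set (Set X)) (S : MeasurableSpace X)
    (hN : IsSmallSystem N) (hAdm : IsAdmissible S N)
    (hUSC : IsUpperSemicontinuous N S) :
    IsUpperSemicontinuous N (STilde S N) := by
  rintro E hE hanti ⟨m, hm⟩ hinf
  choose F hF hFE using fun k => hN.exists_symmDiff_mem_nInf (hE k)
  have hD := hN.iUnion_mem_nInf hFE
  refine hUSC (fun k => ⋂ i, ⋂ (_ : i ≤ k), F i)
    (fun k => MeasurableSet.iInter fun i => MeasurableSet.iInter fun _ => hF i) ?_ ⟨m, ?_⟩ ?_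
  · intro a b hab x hx
    simp only [Set.mem_iInter] at hx ⊢
    exact fun i hi => hx i (hi.trans hab)
  · intro k hk
    refine hm k (hN.2.1 m _ _ (hN.2.2.1 m _ _ hk (mem_nInf.1 hD)) fun x hx => ?_)
    have hx' : ∀ i ≤ k, x ∈ E i := fun i hi => hanti hi hx
    simp only [Set.mem_union, Set.mem_iInter, Set.mem_iUnion, Set.mem_symmDiff]
    grind
  · refine hN.nInf_mono (hN.union_mem_nInf hinf hD) fun x hx => ?_
    have hx' : ∀ i, x ∈ F i := fun i => by
      simp only [Set.mem_iInter] at hx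
      exact hx i i le_rfl
    simp only [Set.mem_union, Set.mem_iInter, Set.mem_iUnion, Set.mem_symmDiff]
    grind
end

section
/- Let (N_n)_{n<ω} be a small system on a nonempty set X and let Y ⊆ X with Y ∉ N_∞. Then there exists a natural number m such that for no subset M of Y do both M ∈ N_m and Y \ M ∈ N_m hold. -/
open MeasureTheory

/-- **Proposition 2.5.** If `(N n)` is a small system on a nonempty set
`X` and `Y ∉ N_∞`, then there is an `m` such that no subset `M` of `Y` has both
`M ∈ N m` and `Y \ M ∈ N m`. -/
theorem exists_level_no_half_splitting
    (X : Type) [Nonempty X] (N : ℕ → Set (Set X)) (hN : IsSmallSystem N)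
    (Y : Set X) (hY : Y ∉ NInf N) :
    ∃ m : ℕ, ∀ M : Set X, M ⊆ Y → ¬ (M ∈ N m ∧ Y \ M ∈ N m) := by
  obtain ⟨h_empty, -, -, h_union, h_dir⟩ := hN
  simp only [NInf, Set.mem_iInter, not_forall] at hY
  obtain ⟨n, hn⟩ := hY
  obtain ⟨n', -, hn'⟩ := h_union n
  obtain ⟨m, -, -, hp, hq⟩ := h_dir (n' + 1) (n' + 2)
  refine ⟨m, fun M hM ⟨hM₁, hM₂⟩ => hn ?_⟩
  let E : ℕ → Set X
    | 0 => M
    | 1 => Y \ M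
    | _ + 2 => ∅
  have hE : ⋃ k, E k = Y := by
    refine subset_antisymm (Set.iUnion_subset ?_) fun y hy => Set.mem_iUnion.2 ?_
    · rintro (_ | _ | k)
      exacts [hM, Set.sdiff_subset, Set.empty_subset _]
    · by_cases hyM : y ∈ M
      exacts [⟨0, hyM⟩, ⟨1, hy, hyM⟩]
  rw [← hE]
  refine hn' (fun k => n' + 1 + k) (add_right_injective _) (fun k => by omega) E ?_
  rintro (_ | _ | k)
  exacts [hp hM₁, hq hM₂, h_empty _]
end

section
/- Let (N_n)_{n<ω} be a small system on a nonempty set X and let S be a σ-algebra on X. If S is admissible with respect to (N_n)_{n<ω}, then S̃, the σ-algebra generated by S together with the σ-ideal N_∞, is also admissible with respect to (N_n)_{n<ω}. -/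
open MeasureTheory

theorem IsSmallSystem.iUnion_mem_NInf {X : Type} {N : ℕ → Set (Set X)} (hN : IsSmallSystem N)
    {E : ℕ → Set X} (hE : ∀ k, E k ∈ NInf N) : (⋃ k, E k) ∈ NInf N := by
  refine Set.mem_iInter.2 fun m => ?_
  obtain ⟨m', -, h⟩ := hN.2.2.2.1 m
  exact h (fun k => m' + 1 + k) (fun a b hab => by simpa using hab) (fun k => by omega) E
    fun k => Set.mem_iInter.1 (hE k) _

/-- Every member of `NInf N` is covered by a measurable member of `NInf N`. -/
theorem IsAdmissible.exists_measurableSet_mem_NInf {X : Type} {N : ℕ → Set (Set X)}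
    {S : MeasurableSpace X} (hN : IsSmallSystem N) (hS : IsAdmissible S N)
    {E : Set X} (hE : E ∈ NInf N) :
    ∃ G : Set X, MeasurableSet[S] G ∧ G ∈ NInf N ∧ E ⊆ G := by
  choose F hFm hFN hEF using fun n => hS.2.1 n E (Set.mem_iInter.1 hE n)
  exact ⟨⋂ n, F n, MeasurableSet.iInter hFm,
    Set.mem_iInter.2 fun n => hN.2.1 n _ _ (hFN n) (Set.iInter_subset F n),
    Set.subset_iInter hEF⟩

/-- Every `STilde S N`-measurable set agrees with an `S`-measurable set off an `S`-measurable
member of `NInf N`. -/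
theorem IsAdmissible.exists_measurableSet_eq_off {X : Type} {N : ℕ → Set (Set X)}
    {S : MeasurableSpace X} (hN : IsSmallSystem N) (hS : IsAdmissible S N)
    {A : Set X} (hA : MeasurableSet[STilde S N] A) :
    ∃ F G : Set X, MeasurableSet[S] F ∧ MeasurableSet[S] G ∧ G ∈ NInf N ∧
      ∀ x, x ∉ G → (x ∈ A ↔ x ∈ F) := by
  have h_empty : (∅ : Set X) ∈ NInf N := Set.mem_iInter.2 hN.1
  induction A, hA using MeasurableSpace.generateFrom_induction with
  | hC A hA _ =>
    rcases hA with hA | hA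
    · exact ⟨A, ∅, hA, MeasurableSet.empty, h_empty, fun _ _ => Iff.rfl⟩
    · obtain ⟨G, hGm, hGN, hAG⟩ := hS.exists_measurableSet_mem_NInf hN hA
      exact ⟨∅, G, MeasurableSet.empty, hGm, hGN, fun x hx => ⟨fun h => hx (hAG h), False.elim⟩⟩
  | empty => exact ⟨∅, ∅, MeasurableSet.empty, MeasurableSet.empty, h_empty, fun _ _ => Iff.rfl⟩
  | compl A _ ih =>
    obtain ⟨F, G, hF, hG, hGN, h⟩ := ih
    exact ⟨Fᶜ, G, hF.compl, hG, hGN, fun x hx => not_congr (h x hx)⟩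
  | iUnion A _ ih =>
    choose F G hF hG hGN h using ih
    refine ⟨⋃ k, F k, ⋃ k, G k, MeasurableSet.iUnion hF, MeasurableSet.iUnion hG,
      hN.iUnion_mem_NInf hGN, fun x hx => ?_⟩
    simp only [Set.mem_iUnion, not_exists] at hx ⊢
    exact exists_congr fun k => h k x (hx k)

/-- An `STilde S N`-measurable set outside `N n` contains an `S`-measurable set outside `N n`. -/
theorem IsAdmissible.exists_measurableSet_subset_notMem {X : Type} {N : ℕ → Set (Set X)}
    {S : MeasurableSpace X} (hN : IsSmallSystem N) (hS : IsAdmissible S N) {n : ℕ}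
    {A : Set X} (hA : MeasurableSet[STilde S N] A) (hAn : A ∉ N n) :
    ∃ B : Set X, MeasurableSet[S] B ∧ B ∉ N n ∧ B ⊆ A := by
  obtain ⟨F, G, hF, hG, hGN, h⟩ := hS.exists_measurableSet_eq_off hN hA
  refine ⟨F \ G, hF.diff hG, fun hB => hAn ?_, fun x hx => (h x hx.2).2 hx.1⟩
  refine hN.2.1 n _ _ (hN.2.2.1 n _ G hB (Set.mem_iInter.1 hGN)) fun x hx => ?_
  by_cases hxG : x ∈ G
  · exact Or.inr hxG
  · exact Or.inl ⟨(h x hxG).1 hx, hxG⟩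

/-- **Proposition 2.6.** If a σ-algebra `S` is admissible with respect to
a small system `(N n)`, then `S̃`, the σ-algebra generated by `S` and the σ-ideal `N_∞`,
is also admissible with respect to `(N n)`. -/
theorem isAdmissible_sTilde
    (X : Type) [Nonempty X] (N : ℕ → Set (Set X)) (S : MeasurableSpace X)
    (hN : IsSmallSystem N) (hAdm : IsAdmissible S N) :
    IsAdmissible (STilde S N) N := by
  have h_le : ∀ A : Set X, MeasurableSet[S] A → MeasurableSet[STilde S N] A :=
    fun A hA => MeasurableSpace.measurableSet_generateFrom (Or.inl hA)
  refine ⟨fun n => ?_, fun n E hE => ?_, fun n C hC hdisj => ?_⟩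
  · obtain ⟨⟨A, hA, hAn⟩, B, hB, hBn⟩ := hAdm.1 n
    exact ⟨⟨A, h_le A hA, hAn⟩, B, h_le B hB, hBn⟩
  · obtain ⟨F, hF, hFn, hEF⟩ := hAdm.2.1 n E hE
    exact ⟨F, h_le F hF, hFn, hEF⟩
  · choose! f hfm hfn hfs using fun A (hA : A ∈ C) =>
      hAdm.exists_measurableSet_subset_notMem hN (hC A hA).1 (hC A hA).2
    have h_inj : Set.InjOn f C := by
      intro A hA B hB hAB
      by_contra hne
      refine hfn A hA ?_
      have h_empty : f A = ∅ := Set.subset_eq_empty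
        (Set.subset_inter (hfs A hA) (hAB ▸ hfs B hB))
        (Set.disjoint_iff_inter_eq_empty.1 (hdisj hA hB hne))
      exact h_empty ▸ hN.1 n
    refine Set.countable_of_injective_of_countable_image h_inj (hAdm.2.2 n (f '' C) ?_ ?_)
    · rintro _ ⟨A, hA, rfl⟩
      exact ⟨hfm A hA, hfn A hA⟩
    · rintro _ ⟨A, hA, rfl⟩ _ ⟨B, hB, rfl⟩ hne
      exact (hdisj hA hB fun h => hne (congrArg f h)).mono (hfs A hA) (hfs B hB)
end

section
/- Let X be an uncountable Polish space and let B ⊆ X be a Bernstein set. Then B is nonmeasurable with respect to the completion of every nonzero, σ-finite, diffused Borel measure on X; i.e., for every Borel measure μ on X that is nonzero, σ-finite, and vanishes on singletons, the set B does not belong to the domain of the completion of μ. -/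
open MeasureTheory

/-- A Bernstein set: both the set and its complement contain no nonempty perfect set. -/
def IsBernstein {X : Type} [TopologicalSpace X] (B : Set X) : Prop :=
  (∀ P : Set X, Perfect P → P.Nonempty → ¬ P ⊆ B) ∧
  (∀ P : Set X, Perfect P → P.Nonempty → ¬ P ⊆ Bᶜ)

/-- A null-measurable set of positive measure for a diffused s-finite Borel measure on a Polish
space contains a nonempty perfect set. -/
theorem exists_perfect_subset_of_measure_ne_zero {X : Type*} [TopologicalSpace X] [PolishSpace X]
    [MeasurableSpace X] [BorelSpace X] {μ : Measure X} [SFinite μ] [NullSingletonClass μ] {E : Set X}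
    (hE : NullMeasurableSet E μ) (hμE : μ E ≠ 0) :
    ∃ P : Set X, Perfect P ∧ P.Nonempty ∧ P ⊆ E := by
  obtain ⟨F, hFE, hF, hFE_ae⟩ := hE.exists_measurable_subset_ae_eq
  have hF_pos : 0 < μ.toFinite F := by
    refine pos_iff_ne_zero.2 fun h => hμE ?_
    rw [← measure_congr hFE_ae]
    exact absolutelyContinuous_toFinite μ h
  obtain ⟨K, hKF, hK, hK_pos⟩ := hF.exists_lt_isClosed_of_ne_top (measure_ne_top _ _) hF_pos
  have hK_unc : ¬ K.Countable := fun h =>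
    hK_pos.ne' (toFinite_absolutelyContinuous μ (h.measure_zero μ))
  obtain ⟨P, hP, hP_ne, hPK⟩ := exists_perfect_nonempty_of_isClosed_of_not_countable hK hK_unc
  exact ⟨P, hP, hP_ne, hPK.trans (hKF.trans hFE)⟩

/-- In an uncountable Polish space `X`, a Bernstein set `B` is
nonmeasurable with respect to the completion of every nonzero, σ-finite, diffused Borel
measure on `X`: it is not null-measurable for any such measure. -/
theorem bernstein_not_nullMeasurable
    (X : Type) [TopologicalSpace X] [PolishSpace X] [Uncountable X]
    [MeasurableSpace X] [BorelSpace X]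
    (B : Set X) (hB : IsBernstein B)
    (μ : Measure X) [SigmaFinite μ]
    (hDiffused : ∀ x : X, μ {x} = 0)
    (hNonzero : 0 < μ Set.univ) :
    ¬ NullMeasurableSet B μ := by
  intro hB_meas
  have : NullSingletonClass μ := ⟨hDiffused⟩
  have null_of_imperfect {E : Set X} (hE : NullMeasurableSet E μ)
      (h : ∀ P : Set X, Perfect P → P.Nonempty → ¬ P ⊆ E) : μ E = 0 := by
    by_contra hμE
    obtain ⟨P, hP, hP_ne, hPE⟩ := exists_perfect_subset_of_measure_ne_zero hE hμE
    exact h P hP hP_ne hPE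
  refine hNonzero.ne' ?_
  rw [← Set.union_compl_self B]
  exact measure_union_null (null_of_imperfect hB_meas hB.1)
    (null_of_imperfect hB_meas.compl hB.2)
end
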